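/- Let q(x) = Σ_{k=0}^{m} q_k x^k be a polynomial over ℤ with q_0 = 1 and q_1 ≥ 0, let n = ⌊√(2 q_1)⌋ ≥ m, and let p(x) = Σ_{k=0}^{m} q_k (x)_{n−k} be the associated n-factorial polynomial. Suppose that p(x) factors over ℤ into linear factors with integer roots, and that (x)_{t+1} divides p(x), where t is the largest root of p(x). Then there exists an increasing Ferrers board B whose rook polynomial is q(x); explicitly, if u_1 ≥ u_2 ≥ ⋯ ≥ u_c are the (possibly repeated) integer roots of p(x)/(x)_{t+1} arranged in nonincreasing order, then B has column height vector (−u_1 + t + 1, −u_2 + t + 2, …, −u_c + t + c). -/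

import Mathlib

open Polynomial

/-- A board is a finite subset of ℕ × ℕ.  `rookNum B k` is the number of placements of `k`
non-attacking rooks on `B`, i.e. `k`-element subsets of `B` in which no two distinct cells
share a column (first coordinate) or a row (second coordinate). -/
def rookNum (B : Finset (ℕ × ℕ)) (k : ℕ) : ℕ :=
  (B.powerset.filter (fun P => P.card = k ∧
    ∀ p ∈ P, ∀ q ∈ P, p ≠ q → p.1 ≠ q.1 ∧ p.2 ≠ q.2)).card

/-- The Ferrers board with `c` columns of heights `h 1, …, h c`:
cells `{(i, j) : 1 ≤ i ≤ c, 1 ≤ j ≤ h i}`. -/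
def ferrersBoard (c : ℕ) (h : ℕ → ℕ) : Finset (ℕ × ℕ) :=
  (Finset.Icc 1 c).biUnion (fun i => ({i} : Finset ℕ) ×ˢ Finset.Icc 1 (h i))

/-- The falling factorial `(x)_i = x(x-1)⋯(x-i+1)` as a polynomial over ℤ. -/
noncomputable def fallingFactorial (i : ℕ) : Polynomial ℤ :=
  ∏ j ∈ Finset.range i, (X - C (j : ℤ))

/-- The `n`-factorial rook polynomial `p_n(B;x) = Σ_{k=0}^n r_k(B) (x)_{n-k}`. -/
noncomputable def nFactRookPoly (B : Finset (ℕ × ℕ)) (n : ℕ) : Polynomial ℤ :=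
  ∑ k ∈ Finset.range (n + 1), C ((rookNum B k : ℤ)) * fallingFactorial (n - k)

/-- The list of nonzero column heights of the Ferrers board with heights `h 1, …, h c`. -/
def nonzeroHeights (c : ℕ) (h : ℕ → ℕ) : List ℕ :=
  ((List.range c).map (fun i => h (i + 1))).filter (fun x => x != 0)

/-- A set of cells no two of which share a column or a row. -/
def IsNonattacking (P : Finset (ℕ × ℕ)) : Prop :=
  ∀ p ∈ P, ∀ q ∈ P, p ≠ q → p.1 ≠ q.1 ∧ p.2 ≠ q.2

open Classical in
/-- The set of placements of `k` non-attacking rooks on `B`. -/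
noncomputable def placements (B : Finset (ℕ × ℕ)) (k : ℕ) : Finset (Finset (ℕ × ℕ)) :=
  B.powerset.filter (fun P => P.card = k ∧ IsNonattacking P)

lemma card_placements (B : Finset (ℕ × ℕ)) (k : ℕ) : (placements B k).card = rookNum B k := by
  unfold placements rookNum IsNonattacking
  congr

lemma mem_placements {B P : Finset (ℕ × ℕ)} {k : ℕ} :
    P ∈ placements B k ↔ P ⊆ B ∧ P.card = k ∧ IsNonattacking P := by
  simp [placements]

lemma mem_ferrersBoard {c : ℕ} {h : ℕ → ℕ} {x : ℕ × ℕ} :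
    x ∈ ferrersBoard c h ↔ (1 ≤ x.1 ∧ x.1 ≤ c) ∧ 1 ≤ x.2 ∧ x.2 ≤ h x.1 := by
  obtain ⟨a, b⟩ := x
  simp only [ferrersBoard, Finset.mem_biUnion, Finset.mem_product, Finset.mem_singleton,
    Finset.mem_Icc]
  constructor
  · rintro ⟨i, hi, rfl, hb⟩
    exact ⟨hi, hb⟩
  · rintro ⟨hi, hb⟩
    exact ⟨a, hi, rfl, hb⟩

lemma rookNum_zero (B : Finset (ℕ × ℕ)) : rookNum B 0 = 1 := by
  rw [← card_placements, Finset.card_eq_one]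
  refine ⟨∅, ?_⟩
  ext P
  rw [mem_placements, Finset.mem_singleton, Finset.card_eq_zero]
  constructor
  · exact fun h => h.2.1
  · rintro rfl
    simp [IsNonattacking]

lemma rookNum_ferrersBoard_zero_succ (h : ℕ → ℕ) (k : ℕ) :
    rookNum (ferrersBoard 0 h) (k + 1) = 0 := by
  rw [← card_placements, Finset.card_eq_zero, Finset.eq_empty_iff_forall_notMem]
  intro P hP
  obtain ⟨hsub, hcard, -⟩ := mem_placements.1 hP
  have : P = ∅ := by simpa [ferrersBoard] using hsub
  simp [this] at hcard

lemma IsNonattacking.mono {P Q : Finset (ℕ × ℕ)} (hQ : IsNonattacking Q) (hPQ : P ⊆ Q) :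
    IsNonattacking P :=
  fun p hp q hq hne => hQ p (hPQ hp) q (hPQ hq) hne

/-- Splitting placements on a Ferrers board according to the rook in the last column. -/
lemma placements_ferrersBoard_succ (c k : ℕ) (h : ℕ → ℕ) :
    placements (ferrersBoard (c + 1) h) (k + 1) =
      placements (ferrersBoard c h) (k + 1) ∪
        ((placements (ferrersBoard c h) k).sigma
          (fun P => Finset.Icc 1 (h (c + 1)) \ P.image Prod.snd)).image
            (fun x => insert (c + 1, x.2) x.1) := by
  ext P
  simp only [Finset.mem_union, Finset.mem_image, Finset.mem_sigma, mem_placements,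
    Finset.mem_sdiff, Finset.mem_Icc, Sigma.exists]
  constructor
  · rintro ⟨hsub, hcard, hna⟩
    by_cases hcol : ∃ j, (c + 1, j) ∈ P
    · right
      obtain ⟨j, hj⟩ := hcol
      refine ⟨P.erase (c + 1, j), j, ⟨⟨?_, ?_, hna.mono (Finset.erase_subset _ _)⟩, ?_, ?_⟩,
        Finset.insert_erase hj⟩
      · intro x hx
        obtain ⟨hne, hxP⟩ := Finset.mem_erase.1 hx
        have h1 := (hna x hxP _ hj hne).1
        have h2 := mem_ferrersBoard.1 (hsub hxP)
        rw [mem_ferrersBoard]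
        simp only at h1
        omega
      · rw [Finset.card_erase_of_mem hj, hcard]
        rfl
      · exact (mem_ferrersBoard.1 (hsub hj)).2
      · rintro ⟨x, hx, hxj⟩
        obtain ⟨hne, hxP⟩ := Finset.mem_erase.1 hx
        exact (hna x hxP _ hj hne).2 hxj
    · left
      refine ⟨fun x hx => ?_, hcard, hna⟩
      have h2 := mem_ferrersBoard.1 (hsub hx)
      have h1 : x.1 ≠ c + 1 := fun he => hcol ⟨x.2, by rw [← he]; exact hx⟩
      rw [mem_ferrersBoard]
      omega
  · rintro (⟨hsub, hcard, hna⟩ | ⟨Q, j, ⟨⟨hsub, hcard, hna⟩, hj, hjQ⟩, rfl⟩)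
    · refine ⟨fun x hx => ?_, hcard, hna⟩
      have h2 := mem_ferrersBoard.1 (hsub hx)
      rw [mem_ferrersBoard]
      omega
    · have hlt : ∀ x ∈ Q, x.1 ≠ c + 1 := fun x hx => by
        have := mem_ferrersBoard.1 (hsub hx)
        omega
      have hrow : ∀ x ∈ Q, x.2 ≠ j := fun x hx he => hjQ ⟨x, hx, he⟩
      refine ⟨fun x hx => ?_, ?_, ?_⟩
      · rw [mem_ferrersBoard]
        rcases Finset.mem_insert.1 hx with rfl | hx
        · exact ⟨by simp, hj⟩
        · have := mem_ferrersBoard.1 (hsub hx)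
          omega
      · rw [Finset.card_insert_of_notMem (fun hm => hlt _ hm rfl), hcard]
      · intro x hx y hy hne
        rcases Finset.mem_insert.1 hx with rfl | hx <;> rcases Finset.mem_insert.1 hy with rfl | hy
        · exact absurd rfl hne
        · exact ⟨(hlt y hy).symm, (hrow y hy).symm⟩
        · exact ⟨hlt x hx, hrow x hx⟩
        · exact hna x hx y hy hne

lemma card_free_rows {c k : ℕ} {h : ℕ → ℕ} (hmono : ∀ i, 1 ≤ i → i ≤ c → h i ≤ h (c + 1))
    {P : Finset (ℕ × ℕ)} (hP : P ∈ placements (ferrersBoard c h) k) :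
    ((Finset.Icc 1 (h (c + 1)) \ P.image Prod.snd).card : ℤ) = h (c + 1) - k := by
  obtain ⟨hsub, hcard, hna⟩ := mem_placements.1 hP
  have himg : P.image Prod.snd ⊆ Finset.Icc 1 (h (c + 1)) := by
    intro j hj
    obtain ⟨x, hx, rfl⟩ := Finset.mem_image.1 hj
    have h1 := mem_ferrersBoard.1 (hsub hx)
    have h2 := hmono x.1 h1.1.1 h1.1.2
    rw [Finset.mem_Icc]
    omega
  have hinj : (P.image Prod.snd).card = k := by
    rw [Finset.card_image_of_injOn, hcard]
    intro x hx y hy hxy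
    by_contra hne
    exact (hna x hx y hy hne).2 hxy
  have hle := Finset.card_le_card himg
  rw [Finset.card_sdiff_of_subset himg, hinj]
  rw [hinj] at hle
  simp only [Nat.card_Icc, Nat.add_sub_cancel] at hle ⊢
  omega

lemma rookNum_ferrersBoard_succ (c k : ℕ) (h : ℕ → ℕ)
    (hmono : ∀ i, 1 ≤ i → i ≤ c → h i ≤ h (c + 1)) :
    (rookNum (ferrersBoard (c + 1) h) (k + 1) : ℤ) =
      rookNum (ferrersBoard c h) (k + 1) +
        ((h (c + 1) : ℤ) - k) * rookNum (ferrersBoard c h) k := by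
  have hcol : ∀ {m : ℕ} {P : Finset (ℕ × ℕ)}, P ∈ placements (ferrersBoard c h) m →
      ∀ j, (c + 1, j) ∉ P := fun hP j hj => by
    have := mem_ferrersBoard.1 ((mem_placements.1 hP).1 hj)
    omega
  rw [← card_placements, placements_ferrersBoard_succ, Finset.card_union_of_disjoint,
    Finset.card_image_of_injOn, Finset.card_sigma, Nat.cast_add, Nat.cast_sum,
    Finset.sum_congr rfl (fun P hP => card_free_rows hmono hP), Finset.sum_const, nsmul_eq_mul,
    card_placements, card_placements, mul_comm]
  · rintro ⟨P, i⟩ hP ⟨Q, j⟩ hQ hPQ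
    simp only [Finset.coe_sigma, Set.mem_sigma_iff, Finset.mem_coe] at hP hQ
    simp only at hPQ
    have hij : i = j := by
      have hmem : (c + 1, i) ∈ insert (c + 1, j) Q := hPQ ▸ Finset.mem_insert_self _ _
      rcases Finset.mem_insert.1 hmem with he | hm
      · exact (Prod.mk.inj he).2
      · exact absurd hm (hcol hQ.1 i)
    subst hij
    have := congrArg (fun S => Finset.erase S (c + 1, i)) hPQ
    simp only [Finset.erase_insert (hcol hP.1 i), Finset.erase_insert (hcol hQ.1 i)] at this
    rw [this]
  · rw [Finset.disjoint_left]
    intro P hP hP'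
    obtain ⟨x, -, rfl⟩ := Finset.mem_image.1 hP'
    exact hcol hP x.2 (Finset.mem_insert_self _ _)

lemma rookNum_ferrersBoard_eq_zero (h : ℕ → ℕ) (c : ℕ)
    (hmono : ∀ i j, 1 ≤ i → i ≤ j → j ≤ c → h i ≤ h j) {k : ℕ} (hk : c < k) :
    rookNum (ferrersBoard c h) k = 0 := by
  induction c generalizing k with
  | zero =>
    obtain ⟨k, rfl⟩ := Nat.exists_eq_succ_of_ne_zero hk.ne'
    exact rookNum_ferrersBoard_zero_succ h k
  | succ c ih =>
    obtain ⟨k, rfl⟩ := Nat.exists_eq_succ_of_ne_zero (Nat.ne_zero_of_lt hk)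
    have ih' := @ih fun i j hi hij hj => hmono i j hi hij (by omega)
    have := rookNum_ferrersBoard_succ c k h fun i hi hic => hmono i _ hi (by omega) le_rfl
    rw [ih' (by omega), ih' (by omega)] at this
    simpa using this

lemma fallingFactorial_succ (i : ℕ) :
    fallingFactorial (i + 1) = fallingFactorial i * (X - C (i : ℤ)) := by
  rw [fallingFactorial, Finset.prod_range_succ, fallingFactorial]

lemma fallingFactorial_monic (i : ℕ) : (fallingFactorial i).Monic :=
  monic_prod_of_monic _ _ fun _ _ => monic_X_sub_C _

lemma natDegree_fallingFactorial (i : ℕ) : (fallingFactorial i).natDegree = i := by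
  rw [fallingFactorial, natDegree_prod_of_monic _ _ fun _ _ => monic_X_sub_C _]
  simp only [natDegree_X_sub_C]
  simp

/-- The Goldman–Joichi–White factorization for a Ferrers board with `s` empty columns prepended. -/
lemma sum_rookNum_mul_fallingFactorial (h : ℕ → ℕ) (s c : ℕ)
    (hmono : ∀ i j, 1 ≤ i → i ≤ j → j ≤ c → h i ≤ h j) :
    ∑ k ∈ Finset.range (c + 1),
        C (rookNum (ferrersBoard c h) k : ℤ) * fallingFactorial (s + c - k) =
      fallingFactorial s * ∏ i ∈ Finset.Icc 1 c, (X - C ((s : ℤ) + i - 1 - h i)) := by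
  induction c with
  | zero => simp [rookNum_zero]
  | succ c ih =>
    have ih' := ih fun i j hi hij hj => hmono i j hi hij (by omega)
    have hrec := fun k => rookNum_ferrersBoard_succ c k h
      fun i hi hic => hmono i _ hi (by omega) le_rfl
    rw [Finset.prod_Icc_succ_top (by omega), ← mul_assoc, ← ih', Finset.sum_range_succ']
    simp only [hrec, C_add, add_mul, Finset.sum_add_distrib]
    rw [add_right_comm, (rookNum_zero _).trans (rookNum_zero (ferrersBoard c h)).symm,
      ← Finset.sum_range_succ' (fun k => C (rookNum (ferrersBoard c h) k : ℤ) *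
        fallingFactorial (s + (c + 1) - k)) (c + 1), Finset.sum_range_succ,
      rookNum_ferrersBoard_eq_zero h c (fun i j hi hij hj => hmono i j hi hij (by omega))
        (Nat.lt_succ_self c)]
    simp only [Nat.cast_zero, C_0, zero_mul, add_zero]
    rw [← Finset.sum_add_distrib, Finset.sum_mul]
    refine Finset.sum_congr rfl fun k hk => ?_
    have hkc : k ≤ c := by simpa [Nat.lt_succ_iff] using hk
    rw [show s + (c + 1) - k = s + c - k + 1 by omega,
      show s + (c + 1) - (k + 1) = s + c - k by omega, fallingFactorial_succ]
    have : ((s + c - k : ℕ) : ℤ) = s + c - k := by omega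
    rw [this]
    simp only [C_mul, C_sub, C_add, Nat.cast_add, Nat.cast_one]
    ring

/-- Falling factorials are linearly independent. -/
lemma eq_of_sum_fallingFactorial_eq {n : ℕ} {a b : ℕ → ℤ}
    (h : ∑ k ∈ Finset.range (n + 1), C (a k) * fallingFactorial (n - k) =
      ∑ k ∈ Finset.range (n + 1), C (b k) * fallingFactorial (n - k)) :
    ∀ k ≤ n, a k = b k := by
  induction n generalizing a b with
  | zero =>
    intro k hk
    obtain rfl : k = 0 := by omega
    simpa [fallingFactorial] using h
  | succ n ih =>
    have hdeg : ∀ d : ℕ → ℤ, (∑ k ∈ Finset.range (n + 1),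
        C (d (k + 1)) * fallingFactorial (n + 1 - (k + 1))).coeff (n + 1) = 0 := fun d => by
      rw [finsetSum_coeff]
      refine Finset.sum_eq_zero fun k _ => ?_
      rw [coeff_C_mul, coeff_eq_zero_of_natDegree_lt, mul_zero]
      rw [natDegree_fallingFactorial]
      omega
    have htop : (fallingFactorial (n + 1)).coeff (n + 1) = 1 := by
      simpa [natDegree_fallingFactorial] using (fallingFactorial_monic (n + 1)).coeff_natDegree
    rw [Finset.sum_range_succ', Finset.sum_range_succ' _ (n + 1)] at h
    have h0 : a 0 = b 0 := by
      have := congrArg (fun f => f.coeff (n + 1)) h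
      simpa only [coeff_add, hdeg (fun k => a k), hdeg (fun k => b k), coeff_C_mul, Nat.sub_zero,
        htop, mul_one, zero_add] using this
    rw [h0, add_left_inj] at h
    simp only [Nat.add_sub_add_right] at h
    have := ih h
    rintro (_ | k) hk
    · exact h0
    · exact this k (by omega)

lemma coeff_fallingFactorial_succ (i : ℕ) :
    2 * (fallingFactorial (i + 1)).coeff i = -((i : ℤ) * (i + 1)) := by
  induction i with
  | zero => simp [fallingFactorial]
  | succ i ih =>
    have htop : (fallingFactorial (i + 1)).coeff (i + 1) = 1 := by
      simpa [natDegree_fallingFactorial] using (fallingFactorial_monic (i + 1)).coeff_natDegree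
    rw [fallingFactorial_succ, mul_sub, coeff_sub, coeff_mul_X, coeff_mul_C, htop, mul_sub, ih]
    push_cast
    ring

/-- The coefficient next to the leading one of an associated `n`-factorial polynomial. -/
lemma coeff_sum_fallingFactorial (a : ℕ → ℤ) (n : ℕ) (ha : a 0 = 1) :
    2 * (∑ k ∈ Finset.range (n + 2), C (a k) * fallingFactorial (n + 1 - k)).coeff n =
      2 * a 1 - n * (n + 1) := by
  have hz : ∀ k ∈ Finset.range n,
      (C (a (k + 1 + 1)) * fallingFactorial (n + 1 - (k + 1 + 1))).coeff n = 0 := fun k hk => by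
    have := Finset.mem_range.1 hk
    rw [coeff_C_mul, coeff_eq_zero_of_natDegree_lt, mul_zero]
    rw [natDegree_fallingFactorial]
    omega
  have htop : (fallingFactorial n).coeff n = 1 := by
    simpa [natDegree_fallingFactorial] using (fallingFactorial_monic n).coeff_natDegree
  rw [Finset.sum_range_succ', Finset.sum_range_succ', coeff_add, coeff_add, finsetSum_coeff,
    Finset.sum_eq_zero hz]
  simp only [zero_add, coeff_C_mul, Nat.add_sub_cancel, Nat.sub_zero, htop, ha, mul_add,
    mul_one, one_mul, coeff_fallingFactorial_succ]
  ring

lemma sum_range_natDegree_eq (q : Polynomial ℤ) {n : ℕ} (hm : q.natDegree ≤ n) :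
    ∑ k ∈ Finset.range (q.natDegree + 1), C (q.coeff k) * fallingFactorial (n - k) =
      ∑ k ∈ Finset.range (n + 1), C (q.coeff k) * fallingFactorial (n - k) := by
  refine Finset.sum_subset (Finset.range_subset_range.2 (by omega)) fun k _ hk => ?_
  rw [Finset.mem_range, not_lt] at hk
  rw [coeff_eq_zero_of_natDegree_lt (by omega)]
  simp

lemma monic_sum_fallingFactorial (a : ℕ → ℤ) (n : ℕ) (ha : a 0 = 1) :
    (∑ k ∈ Finset.range (n + 1), C (a k) * fallingFactorial (n - k)).Monic ∧
    (∑ k ∈ Finset.range (n + 1), C (a k) * fallingFactorial (n - k)).natDegree = n := by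
  have hlt : (∑ k ∈ Finset.range n,
      C (a (k + 1)) * fallingFactorial (n - (k + 1))).degree < n := by
    rw [degree_lt_iff_coeff_zero]
    intro m hm
    rw [finsetSum_coeff]
    refine Finset.sum_eq_zero fun k hk => ?_
    have := Finset.mem_range.1 hk
    rw [coeff_C_mul, coeff_eq_zero_of_natDegree_lt, mul_zero]
    rw [natDegree_fallingFactorial]
    omega
  have hdeg : (fallingFactorial n).degree = n := by
    rw [degree_eq_natDegree (fallingFactorial_monic n).ne_zero, natDegree_fallingFactorial]
  rw [Finset.sum_range_succ', ha]
  simp only [C_1, one_mul, Nat.sub_zero]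
  rw [← hdeg] at hlt
  exact ⟨(fallingFactorial_monic n).add_of_right hlt, by
    rw [natDegree_add_eq_right_of_degree_lt hlt, natDegree_fallingFactorial]⟩

/-- The largest root of the associated `⌊√(2 q₁)⌋`-factorial polynomial is at least `-1`. -/
lemma neg_one_le_of_isGreatest_root {a : ℕ → ℤ} {n : ℕ} (ha0 : a 0 = 1) (ha1 : 0 ≤ a 1)
    (hn : n = Nat.sqrt (2 * (a 1).toNat)) {p : Polynomial ℤ}
    (hp : p = ∑ k ∈ Finset.range (n + 1), C (a k) * fallingFactorial (n - k))
    {s : Multiset ℤ} (hs : p = (s.map (fun r => X - C r)).prod)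
    {t : ℤ} (ht : IsGreatest {r : ℤ | p.IsRoot r} t) : -1 ≤ t := by
  by_contra! hlt
  have hcard : s.card = n := by
    rw [← natDegree_multiset_prod_X_sub_C_eq_card s, ← hs, hp]
    exact (monic_sum_fallingFactorial a n ha0).2
  have hroot : ∀ r ∈ s, r ≤ t := fun r hr => ht.2 <| by
    rw [Set.mem_ofPred_eq, hs, IsRoot, eval_multiset_prod, Multiset.prod_eq_zero_iff]
    simp only [Multiset.map_map, Multiset.mem_map]
    exact ⟨r, hr, by simp⟩
  obtain _ | m := n
  · rw [Multiset.card_eq_zero] at hcard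
    have := ht.1
    rw [hs, hcard] at this
    simp at this
  have hcoeff := multiset_prod_X_sub_C_coeff_card_pred s (by omega)
  rw [← hs, hcard, Nat.add_sub_cancel] at hcoeff
  have h2 := coeff_sum_fallingFactorial a m ha0
  rw [← hp, hcoeff] at h2
  have hsum := Multiset.sum_le_card_nsmul s t hroot
  rw [hcard, nsmul_eq_mul] at hsum
  have hsq := Nat.lt_succ_sqrt (2 * (a 1).toNat)
  rw [← hn] at hsq
  zify at hsq
  rw [Int.toNat_of_nonneg ha1] at hsq
  push_cast at *
  nlinarith

/-- A polynomial with only integer roots is determined by a nonincreasing sequence of them. -/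
lemma exists_antitone_eq_prod (s : Multiset ℤ) :
    ∃ u : ℕ → ℤ, (∀ i j, 1 ≤ i → i ≤ j → j ≤ s.card → u j ≤ u i) ∧
      (s.map (fun r => X - C r)).prod = ∏ i ∈ Finset.Icc 1 s.card, (X - C (u i)) := by
  set l := s.sort (· ≥ ·) with hl
  have hlen : l.length = s.card := Multiset.length_sort _
  refine ⟨fun i => l.getD (i - 1) 0, fun i j hi hij hj => ?_, ?_⟩
  · have hsort : l.Pairwise (· ≥ ·) := Multiset.pairwise_sort _ _
    simp only
    rw [List.getD_eq_getElem _ _ (by omega), List.getD_eq_getElem _ _ (by omega)]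
    rcases hij.eq_or_lt with rfl | hlt
    · rfl
    · exact List.pairwise_iff_getElem.1 hsort _ _ (by omega) (by omega) (by omega)
  · conv_lhs => rw [← Multiset.sort_eq s (· ≥ ·)]
    rw [Multiset.map_coe, Multiset.prod_coe, ← hl, ← hlen]
    rw [← Finset.Ico_succ_right_eq_Icc, Finset.prod_Ico_eq_prod_range]
    simp only [Nat.succ_eq_succ, Nat.succ_eq_add_one, Nat.add_sub_cancel, Nat.add_sub_cancel_left]
    rw [← Fin.prod_univ_fun_getElem, Finset.prod_range]
    simp

lemma exists_multiset_of_mul_eq {f g : Polynomial ℤ} (hf : f.Monic) {s : Multiset ℤ}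
    (h : (s.map (fun r => X - C r)).prod = f * g) :
    ∃ v : Multiset ℤ, g = (v.map (fun r => X - C r)).prod := by
  have hmon : (f * g).Monic := h ▸ monic_multiset_prod_of_monic _ _ fun _ _ => monic_X_sub_C _
  have hg : g.Monic := hf.of_mul_monic_left hmon
  have hsplit : (f * g).Splits := by
    rw [← h]
    refine Splits.multisetProd fun f hf => ?_
    obtain ⟨r, -, rfl⟩ := Multiset.mem_map.1 hf
    exact Splits.X_sub_C r
  have hgs : g.Splits := hsplit.of_dvd hmon.ne_zero (dvd_mul_left _ _)
  exact ⟨g.roots, hgs.eq_prod_roots_of_monic hg⟩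

/-- Converse construction: if `q ∈ ℤ[x]` has `q_0 = 1`, `q_1 ≥ 0`, `n = ⌊√(2 q_1)⌋ ≥ deg q`,
and the associated `n`-factorial polynomial `p(x) = Σ_k q_k (x)_{n-k}` factors over ℤ into
linear factors with integer roots and is divisible by `(x)_{t+1}` where `t` is its largest
root, then `q` is the rook polynomial of an increasing Ferrers board; explicitly, if
`u 1 ≥ u 2 ≥ ⋯ ≥ u c` are the roots of `p(x)/(x)_{t+1}` in nonincreasing order, then the
board with column heights `(-u i + t + i)` (for `i = 1, …, c`) works. -/
theorem rook_poly_sufficient_conditions (q : Polynomial ℤ)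
    (hq0 : q.coeff 0 = 1) (hq1 : 0 ≤ q.coeff 1)
    (n : ℕ) (hn : n = Nat.sqrt (2 * (q.coeff 1).toNat)) (hm : q.natDegree ≤ n)
    (p : Polynomial ℤ)
    (hp : p = ∑ k ∈ Finset.range (q.natDegree + 1), C (q.coeff k) * fallingFactorial (n - k))
    (hfact : ∃ s : Multiset ℤ, p = (s.map (fun a => X - C a)).prod)
    (t : ℤ) (ht : IsGreatest {r : ℤ | p.IsRoot r} t)
    (hdiv : fallingFactorial (t + 1).toNat ∣ p) :
    (∃ (c : ℕ) (hcol : ℕ → ℕ),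
      (∀ i j, 1 ≤ i → i < j → j ≤ c → hcol i < hcol j) ∧
      ∀ k, (rookNum (ferrersBoard c hcol) k : ℤ) = q.coeff k) ∧
    (∀ (c : ℕ) (u : ℕ → ℤ),
      (∀ i j, 1 ≤ i → i ≤ j → j ≤ c → u j ≤ u i) →
      p = fallingFactorial (t + 1).toNat * ∏ i ∈ Finset.Icc 1 c, (X - C (u i)) →
      (∀ i j, 1 ≤ i → i < j → j ≤ c →
        (t + (i : ℤ) - u i).toNat < (t + (j : ℤ) - u j).toNat) ∧
      ∀ k, (rookNum (ferrersBoard c (fun i => (t + (i : ℤ) - u i).toNat)) k : ℤ) =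
        q.coeff k) := by
  obtain ⟨s, hs⟩ := hfact
  rw [sum_range_natDegree_eq q hm] at hp
  have ht1 : -1 ≤ t := neg_one_le_of_isGreatest_root hq0 hq1 hn hp hs ht
  obtain ⟨w, hw⟩ : ∃ w : ℕ, (w : ℤ) = t + 1 := ⟨(t + 1).toNat, by omega⟩
  have hwt : (t + 1).toNat = w := by omega
  rw [hwt] at hdiv ⊢
  have hmain : ∀ (c : ℕ) (u : ℕ → ℤ),
      (∀ i j, 1 ≤ i → i ≤ j → j ≤ c → u j ≤ u i) →
      p = fallingFactorial w * ∏ i ∈ Finset.Icc 1 c, (X - C (u i)) →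
      (∀ i j, 1 ≤ i → i < j → j ≤ c →
        (t + (i : ℤ) - u i).toNat < (t + (j : ℤ) - u j).toNat) ∧
      ∀ k, (rookNum (ferrersBoard c (fun i => (t + (i : ℤ) - u i).toNat)) k : ℤ) =
        q.coeff k := by
    intro c u hu hpu
    have hut : ∀ i, 1 ≤ i → i ≤ c → u i ≤ t := fun i hi hic => ht.2 <| by
      rw [Set.mem_ofPred_eq, hpu, IsRoot, eval_mul, eval_prod,
        Finset.prod_eq_zero (Finset.mem_Icc.2 ⟨hi, hic⟩) (by simp), mul_zero]
    have hstrict : ∀ i j, 1 ≤ i → i < j → j ≤ c →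
        (t + (i : ℤ) - u i).toNat < (t + (j : ℤ) - u j).toNat := fun i j hi hij hj => by
      have h1 := hu i j hi hij.le hj
      have h2 := hut j (by omega) hj
      omega
    refine ⟨hstrict, ?_⟩
    set h : ℕ → ℕ := fun i => (t + (i : ℤ) - u i).toNat with hh
    have hmono : ∀ i j, 1 ≤ i → i ≤ j → j ≤ c → h i ≤ h j := fun i j hi hij hj => by
      rcases hij.eq_or_lt with rfl | hlt
      · rfl
      · exact (hstrict i j hi hlt hj).le
    have hwc : w + c = n := by
      rw [← (monic_sum_fallingFactorial q.coeff n hq0).2, ← hp, hpu,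
        (fallingFactorial_monic w).natDegree_mul
          (monic_prod_of_monic _ _ fun _ _ => monic_X_sub_C _),
        natDegree_fallingFactorial, natDegree_prod_of_monic _ _ fun _ _ => monic_X_sub_C _]
      simp only [natDegree_X_sub_C]
      simp
    have hgjw := sum_rookNum_mul_fallingFactorial h w c hmono
    have hprod : ∏ i ∈ Finset.Icc 1 c, (X - C ((w : ℤ) + i - 1 - h i)) =
        ∏ i ∈ Finset.Icc 1 c, (X - C (u i)) := Finset.prod_congr rfl fun i hi => by
      obtain ⟨h1, h2⟩ := Finset.mem_Icc.1 hi
      have := hut i h1 h2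
      congr 2
      simp only [hh]
      omega
    rw [hprod, ← hpu, hwc, hp, Finset.sum_subset
      (Finset.range_subset_range.2 (show c + 1 ≤ n + 1 by omega))] at hgjw
    · intro k
      by_cases hk : k ≤ n
      · exact eq_of_sum_fallingFactorial_eq
          (a := fun k => (rookNum (ferrersBoard c h) k : ℤ)) hgjw k hk
      · rw [rookNum_ferrersBoard_eq_zero h c hmono (by omega),
          coeff_eq_zero_of_natDegree_lt (by omega), Nat.cast_zero]
    · intro k _ hk
      rw [Finset.mem_range, not_lt] at hk
      rw [rookNum_ferrersBoard_eq_zero h c hmono (by omega)]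
      simp
  refine ⟨?_, hmain⟩
  obtain ⟨g, hg⟩ := hdiv
  obtain ⟨v, hv⟩ := exists_multiset_of_mul_eq (fallingFactorial_monic w) (hs.symm.trans hg)
  obtain ⟨u, hu, huv⟩ := exists_antitone_eq_prod v
  obtain ⟨h1, h2⟩ := hmain v.card u hu (by rw [hg, hv, huv])
  exact ⟨v.card, _, h1, h2⟩
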